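/- arXiv:2003.05514 — 7 statements merged into one kernel-verified Lean document; each statement's English description precedes it below -/
import Mathlib

section
/- Let G be a (3,6)-sparse finite simple graph and let A and B be subgraphs of G, each (3,6)-tight, such that the intersection A ⊓ B has at least 3 vertices. Then both A ⊔ B and A ⊓ B are (3,6)-tight. -/
/-- A finite simple graph is (3,6)-sparse if every subgraph with at least 3
vertices satisfies `|E'| ≤ 3|V'| − 6`. -/
def SimpleGraph.Sparse36 {V : Type*} [Fintype V] (G : SimpleGraph V) : Prop :=
  ∀ H : G.Subgraph, 3 ≤ H.verts.ncard →
    (H.edgeSet.ncard : ℤ) ≤ 3 * (H.verts.ncard : ℤ) - 6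

/-- A subgraph `A` of `G` is (3,6)-tight if every subgraph of it with at least
3 vertices satisfies `|E'| ≤ 3|V'| − 6`, and `|E(A)| = 3|V(A)| − 6`. -/
def SimpleGraph.Subgraph.Tight36 {V : Type*} [Fintype V] {G : SimpleGraph V}
    (A : G.Subgraph) : Prop :=
  (∀ K : G.Subgraph, K ≤ A → 3 ≤ K.verts.ncard →
      (K.edgeSet.ncard : ℤ) ≤ 3 * (K.verts.ncard : ℤ) - 6) ∧
    (A.edgeSet.ncard : ℤ) = 3 * (A.verts.ncard : ℤ) - 6

/-- If `G` is (3,6)-sparse and `A`, `B` are (3,6)-tight subgraphs whose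
intersection has at least 3 vertices, then `A ⊔ B` and `A ⊓ B` are (3,6)-tight. -/
theorem tight_sup_and_inf {V : Type*} [Fintype V] (G : SimpleGraph V)
    (hG : G.Sparse36) (A B : G.Subgraph)
    (hA : A.Tight36) (hB : B.Tight36)
    (hAB : 3 ≤ (A ⊓ B).verts.ncard) :
    (A ⊔ B).Tight36 ∧ (A ⊓ B).Tight36 := by
  have hverts := Set.ncard_union_add_ncard_inter A.verts B.verts
  have hedges := Set.ncard_union_add_ncard_inter A.edgeSet B.edgeSet
  rw [← SimpleGraph.Subgraph.verts_sup, ← SimpleGraph.Subgraph.verts_inf] at hverts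
  rw [← SimpleGraph.Subgraph.edgeSet_sup, ← SimpleGraph.Subgraph.edgeSet_inf] at hedges
  have hle : (A ⊓ B).verts.ncard ≤ (A ⊔ B).verts.ncard :=
    Set.ncard_le_ncard (SimpleGraph.Subgraph.verts_mono (inf_le_left.trans le_sup_left))
  have hsup := hG (A ⊔ B) (hAB.trans hle)
  have hinf := hG (A ⊓ B) hAB
  have hA' := hA.2
  have hB' := hB.2
  exact ⟨⟨fun K _ hK => hG K hK, by omega⟩, ⟨fun K _ hK => hG K hK, by omega⟩⟩
end

section
/- Let G be a (3,6)-tight finite simple graph, and let A, H be subgraphs of G with A ⊔ H = G and A ⊓ H = C, where A has at least 3 vertices. Suppose K is a subgraph of G with at least 3 vertices, every subgraph of K with at least 3 vertices K' satisfies |E(K')| ≤ 3|V(K')| − 6, f(K) = 7, and K ⊓ H = C. Then f(C) − 1 ≤ f(H) ≤ f(C). -/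
/-- A finite simple graph is (3,6)-tight if it is (3,6)-sparse and
`|E| = 3|V| − 6`. -/
def SimpleGraph.Tight36 {V : Type*} [Fintype V] (G : SimpleGraph V) : Prop :=
  G.Sparse36 ∧ (G.edgeSet.ncard : ℤ) = 3 * (Fintype.card V : ℤ) - 6

/-- The freedom number of a subgraph `H`, `f(H) = 3|V(H)| − |E(H)|`. -/
noncomputable def SimpleGraph.Subgraph.freedom {V : Type*} [Fintype V] {G : SimpleGraph V}
    (H : G.Subgraph) : ℤ :=
  3 * (H.verts.ncard : ℤ) - (H.edgeSet.ncard : ℤ)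

/-- The freedom number is modular on the lattice of subgraphs. -/
theorem SimpleGraph.Subgraph.freedom_sup_add_freedom_inf {V : Type*} [Fintype V]
    {G : SimpleGraph V} (A B : G.Subgraph) :
    (A ⊔ B).freedom + (A ⊓ B).freedom = A.freedom + B.freedom := by
  have hv := Set.ncard_union_add_ncard_inter A.verts B.verts
  have he := Set.ncard_union_add_ncard_inter A.edgeSet B.edgeSet
  simp only [freedom, verts_sup, verts_inf, edgeSet_sup, edgeSet_inf]
  lia

theorem SimpleGraph.Sparse36.six_le_freedom {V : Type*} [Fintype V] {G : SimpleGraph V}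
    (hG : G.Sparse36) (A : G.Subgraph) (hA : 3 ≤ A.verts.ncard) : 6 ≤ A.freedom := by
  have h := hG A hA
  unfold Subgraph.freedom
  lia

theorem SimpleGraph.Tight36.freedom_top {V : Type*} [Fintype V] {G : SimpleGraph V}
    (hG : G.Tight36) : (⊤ : G.Subgraph).freedom = 6 := by
  have h := hG.2
  simp only [Subgraph.freedom, Subgraph.verts_top, Subgraph.edgeSet_top, Set.ncard_univ,
    Nat.card_eq_fintype_card]
  lia

/-- The filling-in lemma, second case: if `G` is (3,6)-tight, `G = A ⊔ H`,
`A ⊓ H = C`, `A` has at least 3 vertices, and `K` is a (3,6)-sparse subgraph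
of `G` with at least 3 vertices, `f(K) = 7` and `K ⊓ H = C`, then
`f(C) − 1 ≤ f(H) ≤ f(C)`. -/
theorem fillingIn_sparse_seven {V : Type*} [Fintype V] (G : SimpleGraph V)
    (hG : G.Tight36) (A H C K : G.Subgraph)
    (hAH : A ⊔ H = ⊤) (hC : A ⊓ H = C) (hA : 3 ≤ A.verts.ncard)
    (hKcard : 3 ≤ K.verts.ncard)
    (hKsparse : ∀ K' : G.Subgraph, K' ≤ K → 3 ≤ K'.verts.ncard →
      (K'.edgeSet.ncard : ℤ) ≤ 3 * (K'.verts.ncard : ℤ) - 6)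
    (hKfreedom : K.freedom = 7)
    (hKH : K ⊓ H = C) :
    C.freedom - 1 ≤ H.freedom ∧ H.freedom ≤ C.freedom := by
  have hAHf := A.freedom_sup_add_freedom_inf H
  rw [hAH, hC, hG.freedom_top] at hAHf
  have hKHf := K.freedom_sup_add_freedom_inf H
  rw [hKH, hKfreedom] at hKHf
  have hAf := hG.1.six_le_freedom A hA
  have hKHsup := hG.1.six_le_freedom (K ⊔ H) <|
    hKcard.trans (Set.ncard_le_ncard Set.subset_union_left)
  lia
end

section
/- A finite simple graph on exactly 6 vertices is (3,6)-tight if and only if it is isomorphic to a graph obtained from the complete graph K₆ by deleting three distinct edges that do not all share a common vertex (equivalently, the three deleted edges form a triangle, a path of three edges, a two-edge path together with a disjoint edge, or three pairwise disjoint edges). -/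
/-- A graph and its complement together have as many edges as the complete graph. -/
theorem SimpleGraph.ncard_edgeSet_add_ncard_edgeSet_compl {V : Type*} [Fintype V]
    (G : SimpleGraph V) :
    G.edgeSet.ncard + Gᶜ.edgeSet.ncard = (Fintype.card V).choose 2 := by
  classical
  rw [← Set.ncard_union_eq (SimpleGraph.disjoint_edgeSet.2 disjoint_compl_right),
    ← SimpleGraph.edgeSet_sup, sup_compl_eq_top, ← SimpleGraph.coe_edgeFinset,
    Set.ncard_coe_finset, SimpleGraph.card_edgeFinset_top_eq_card_choose_two]

/-- The edges at `v` in `G` and in its complement are as many as the other vertices. -/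
theorem SimpleGraph.ncard_incidenceSet_add_ncard_incidenceSet_compl {V : Type*} [Fintype V]
    (G : SimpleGraph V) (v : V) :
    (G.incidenceSet v).ncard + (Gᶜ.incidenceSet v).ncard = Fintype.card V - 1 := by
  classical
  rw [Set.ncard_eq_toFinset_card', Set.ncard_eq_toFinset_card', Set.toFinset_card,
    Set.toFinset_card, SimpleGraph.card_incidenceSet_eq_degree,
    SimpleGraph.card_incidenceSet_eq_degree, SimpleGraph.degree_compl]
  have := G.degree_lt_card_verts v
  omega

/-- A subgraph on `n` vertices has at most `n.choose 2` edges. -/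
theorem SimpleGraph.Subgraph.ncard_edgeSet_le_choose_two {V : Type*} [Fintype V]
    {G : SimpleGraph V} (H : G.Subgraph) :
    H.edgeSet.ncard ≤ H.verts.ncard.choose 2 := by
  classical
  rw [← H.image_coe_edgeSet_coe]
  refine (Set.ncard_image_le (Set.toFinite _)).trans ?_
  rw [← SimpleGraph.coe_edgeFinset, Set.ncard_coe_finset]
  refine H.coe.card_edgeFinset_le_card_choose_two.trans ?_
  rw [← Nat.card_eq_fintype_card, Nat.card_coe_set_eq]

/-- A subgraph avoiding `v` has no edge at `v`. -/
theorem SimpleGraph.Subgraph.edgeSet_subset_diff_incidenceSet {V : Type*}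
    {G : SimpleGraph V} (H : G.Subgraph) {v : V} (hv : v ∉ H.verts) :
    H.edgeSet ⊆ G.edgeSet \ G.incidenceSet v := fun _ he =>
  ⟨H.edgeSet_subset he, fun hi => hv (H.mem_verts_of_mem_edge he hi.2)⟩

/-- The edges of `G` that avoid `v` are the edges of `G - v`. -/
theorem SimpleGraph.edgeSet_induce_compl_singleton {V : Type*} (G : SimpleGraph V) (v : V) :
    ((⊤ : G.Subgraph).induce {v}ᶜ).edgeSet = G.edgeSet \ G.incidenceSet v := by
  ext e
  induction e with
  | h x y =>
    simp only [SimpleGraph.Subgraph.mem_edgeSet, SimpleGraph.Subgraph.induce_adj,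
      Set.mem_compl_iff, Set.mem_singleton_iff, SimpleGraph.Subgraph.top_adj, Set.mem_sdiff,
      SimpleGraph.mem_edgeSet, SimpleGraph.mk'_mem_incidenceSet_iff]
    grind

/-- A graph on six vertices is (3,6)-tight iff exactly three edges are missing from it and no
vertex lies on all of them. -/
theorem SimpleGraph.tight36_iff_edgeSet_compl {V : Type*} [Fintype V]
    (G : SimpleGraph V) (hV : Fintype.card V = 6) :
    G.Tight36 ↔ Gᶜ.edgeSet.ncard = 3 ∧ ¬ ∃ v, ∀ e ∈ Gᶜ.edgeSet, v ∈ e := by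
  have hE := G.ncard_edgeSet_add_ncard_edgeSet_compl
  rw [hV, show Nat.choose 6 2 = 15 from rfl] at hE
  have hI := G.ncard_incidenceSet_add_ncard_incidenceSet_compl
  rw [hV] at hI
  have hD (v : V) := Set.ncard_sdiff_add_ncard_of_subset (G.incidenceSet_subset v)
  have hC (v : V) : ({v}ᶜ : Set V).ncard = 5 := by
    have := Set.ncard_add_ncard_compl ({v} : Set V)
    rw [Set.ncard_singleton, Nat.card_eq_fintype_card, hV] at this
    omega
  unfold SimpleGraph.Tight36
  rw [hV]
  constructor
  · rintro ⟨hs, ht⟩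
    refine ⟨by omega, ?_⟩
    rintro ⟨v, hv⟩
    have hinc : Gᶜ.incidenceSet v = Gᶜ.edgeSet :=
      Set.Subset.antisymm (Gᶜ.incidenceSet_subset v) fun e he => ⟨he, hv e he⟩
    have h := hs ((⊤ : G.Subgraph).induce {v}ᶜ)
    rw [G.edgeSet_induce_compl_singleton, SimpleGraph.Subgraph.induce_verts, hC] at h
    have h1 := hI v
    have h2 := hD v
    rw [hinc] at h1
    omega
  · rintro ⟨h3, hv⟩
    refine ⟨fun H hH => ?_, by omega⟩
    have hle : H.verts.ncard ≤ 6 := by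
      have := Set.ncard_le_card H.verts
      rwa [Nat.card_eq_fintype_card, hV] at this
    have hch := H.ncard_edgeSet_le_choose_two
    have hG := Set.ncard_le_ncard H.edgeSet_subset
    rcases (by omega : H.verts.ncard = 3 ∨ H.verts.ncard = 4 ∨ H.verts.ncard = 5 ∨
      H.verts.ncard = 6) with h | h | h | h <;> rw [h] at hch ⊢
    · rw [show Nat.choose 3 2 = 3 from rfl] at hch
      omega
    · rw [show Nat.choose 4 2 = 6 from rfl] at hch
      omega
    · obtain ⟨v, hvH⟩ : ∃ v, v ∉ H.verts := by
        by_contra! hall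
        rw [Set.eq_univ_of_forall hall, Set.ncard_univ, Nat.card_eq_fintype_card, hV] at h
        omega
      have h1 := hI v
      have h2 := hD v
      have h4 := Set.ncard_le_ncard (H.edgeSet_subset_diff_incidenceSet hvH)
      have h5 : (Gᶜ.incidenceSet v).ncard < Gᶜ.edgeSet.ncard := by
        refine Set.ncard_lt_ncard ((Gᶜ.incidenceSet_subset v).ssubset_of_ne fun heq => ?_)
        exact hv ⟨v, fun e he => (heq.symm ▸ he : e ∈ Gᶜ.incidenceSet v).2⟩
      omega
    · omega

/-- An isomorphism onto a complete graph with the edges `S` removed is a bijection of the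
vertices which carries the missing edges to `S`. -/
theorem SimpleGraph.nonempty_iso_deleteEdges_iff {V W : Type*} (G : SimpleGraph V)
    {S : Set (Sym2 W)} (hS : ∀ e ∈ S, ¬ e.IsDiag) :
    Nonempty (G ≃g (⊤ : SimpleGraph W).deleteEdges S) ↔
      ∃ f : V ≃ W, Sym2.map f '' Gᶜ.edgeSet = S := by
  have key (f : V ≃ W) : Sym2.map f '' Gᶜ.edgeSet = S ↔
      ∀ x y, ((⊤ : SimpleGraph W).deleteEdges S).Adj (f x) (f y) ↔ G.Adj x y := by
    have hmem (x y : V) : s(f x, f y) ∈ Sym2.map f '' Gᶜ.edgeSet ↔ x ≠ y ∧ ¬ G.Adj x y := by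
      rw [← Sym2.map_mk, (Sym2.map.injective f.injective).mem_set_image,
        SimpleGraph.mem_edgeSet, SimpleGraph.compl_adj]
    simp only [SimpleGraph.deleteEdges_adj, SimpleGraph.top_adj, f.injective.ne_iff]
    constructor
    · rintro rfl x y
      rw [hmem]
      have := G.ne_of_adj (a := x) (b := y)
      tauto
    · intro h
      ext e
      induction e with
      | h u v =>
        obtain ⟨x, rfl⟩ := f.surjective u
        obtain ⟨y, rfl⟩ := f.surjective v
        have hxy : s(f x, f y) ∈ S → x ≠ y := fun hs hne => hS _ hs (by simp [hne])
        rw [hmem, ← h]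
        tauto
  constructor
  · rintro ⟨φ⟩
    exact ⟨φ.toEquiv, (key _).2 fun _ _ => φ.map_rel_iff⟩
  · rintro ⟨f, hf⟩
    exact ⟨⟨f, fun {x y} => (key f).1 hf x y⟩⟩

/-- A finite simple graph on exactly 6 vertices is (3,6)-tight iff it is
isomorphic to `K₆` minus three distinct (non-loop) edges that do not all
share a common vertex. -/
theorem tight_six_vertices_iff_K6_minus_three_edges {V : Type*} [Fintype V]
    (G : SimpleGraph V) (hV : Fintype.card V = 6) :
    G.Tight36 ↔
      ∃ e₁ e₂ e₃ : Sym2 (Fin 6),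
        e₁ ≠ e₂ ∧ e₁ ≠ e₃ ∧ e₂ ≠ e₃ ∧
        ¬ e₁.IsDiag ∧ ¬ e₂.IsDiag ∧ ¬ e₃.IsDiag ∧
        (¬ ∃ v : Fin 6, v ∈ e₁ ∧ v ∈ e₂ ∧ v ∈ e₃) ∧
        Nonempty (G ≃g (⊤ : SimpleGraph (Fin 6)).deleteEdges {e₁, e₂, e₃}) := by
  rw [G.tight36_iff_edgeSet_compl hV]
  constructor
  · rintro ⟨h3, hv⟩
    obtain ⟨a, b, c, hab, hac, hbc, habc⟩ := Set.ncard_eq_three.1 h3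
    have f : V ≃ Fin 6 := Fintype.equivFinOfCardEq hV
    have hinj := Sym2.map.injective f.injective
    have hdiag (e : Sym2 V) (he : e ∈ Gᶜ.edgeSet) : ¬ (Sym2.map f e).IsDiag := by
      rw [Sym2.isDiag_map f.injective]
      exact Gᶜ.not_isDiag_of_mem_edgeSet he
    have ha := hdiag a (by simp [habc])
    have hb := hdiag b (by simp [habc])
    have hc := hdiag c (by simp [habc])
    refine ⟨Sym2.map f a, Sym2.map f b, Sym2.map f c, hinj.ne hab, hinj.ne hac, hinj.ne hbc,
      ha, hb, hc, ?_, ?_⟩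
    · rintro ⟨w, h⟩
      refine hv ⟨f.symm w, ?_⟩
      simpa [habc, Sym2.mem_map, ← f.eq_symm_apply] using h
    · rw [G.nonempty_iso_deleteEdges_iff (by simp [ha, hb, hc])]
      exact ⟨f, by simp [habc, Set.image_insert_eq]⟩
  · rintro ⟨a, b, c, hab, hac, hbc, ha, hb, hc, hv, hiso⟩
    rw [G.nonempty_iso_deleteEdges_iff (by simp [ha, hb, hc])] at hiso
    obtain ⟨f, hf⟩ := hiso
    constructor
    · rw [← Set.ncard_image_of_injective _ (Sym2.map.injective f.injective), hf]
      exact Set.ncard_eq_three.2 ⟨a, b, c, hab, hac, hbc, rfl⟩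
    · rintro ⟨v, h⟩
      have h' : ∀ e ∈ ({a, b, c} : Set (Sym2 (Fin 6))), f v ∈ e := by
        rw [← hf]
        rintro _ ⟨e, he, rfl⟩
        exact Sym2.mem_map.2 ⟨v, h e he, rfl⟩
      exact hv ⟨f v, h' a (by simp), h' b (by simp), h' c (by simp)⟩
end

section
/- The octahedron graph, obtained from the complete graph K₆ by deleting a perfect matching (three pairwise disjoint edges), is 3-rigid; that is, it admits an infinitesimally rigid framework in ℝ³. -/
open scoped RealInnerProductSpace

/-- An infinitesimal flex of the framework `(G, p)` in `ℝ³`. -/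
def SimpleGraph.IsInfFlex {V : Type*} (G : SimpleGraph V)
    (p q : V → EuclideanSpace ℝ (Fin 3)) : Prop :=
  ∀ ⦃u v : V⦄, G.Adj u v → ⟪p u - p v, q u - q v⟫ = 0

/-- A trivial flex: `q = A ∘ p + c` for a skew-symmetric linear map `A` and a
constant vector `c`. -/
def IsTrivialFlex {V : Type*} (p q : V → EuclideanSpace ℝ (Fin 3)) : Prop :=
  ∃ (A : EuclideanSpace ℝ (Fin 3) →ₗ[ℝ] EuclideanSpace ℝ (Fin 3))
    (c : EuclideanSpace ℝ (Fin 3)),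
    (∀ x y : EuclideanSpace ℝ (Fin 3), ⟪A x, y⟫ = -⟪x, A y⟫) ∧
    ∀ v : V, q v = A (p v) + c

/-- The framework `(G, p)` is infinitesimally rigid if every infinitesimal
flex is trivial. -/
def SimpleGraph.IsInfRigid {V : Type*} (G : SimpleGraph V)
    (p : V → EuclideanSpace ℝ (Fin 3)) : Prop :=
  ∀ q : V → EuclideanSpace ℝ (Fin 3), G.IsInfFlex p q → IsTrivialFlex p q

/-- A graph is 3-rigid if it admits an infinitesimally rigid framework in `ℝ³`. -/
def SimpleGraph.ThreeRigid {V : Type*} (G : SimpleGraph V) : Prop :=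
  ∃ p : V → EuclideanSpace ℝ (Fin 3), G.IsInfRigid p

/-- The linear map of `ℝ³` given by the skew-symmetric matrix with lower entries `a`, `b`, `c`. -/
noncomputable def skewMap (a b c : ℝ) :
    EuclideanSpace ℝ (Fin 3) →ₗ[ℝ] EuclideanSpace ℝ (Fin 3) :=
  Matrix.toEuclideanLin !![0, -a, -b; a, 0, -c; b, c, 0]

theorem skewMap_apply (a b c : ℝ) (x : EuclideanSpace ℝ (Fin 3)) :
    skewMap a b c x = !₂[-a * x 1 - b * x 2, a * x 0 - c * x 2, b * x 0 + c * x 1] := by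
  ext i
  fin_cases i <;>
    simp [skewMap, Matrix.toLpLin_apply, dotProduct, Fin.sum_univ_three] <;> ring

theorem inner_skewMap_left (a b c : ℝ) (x y : EuclideanSpace ℝ (Fin 3)) :
    ⟪skewMap a b c x, y⟫ = -⟪x, skewMap a b c y⟫ := by
  simp [skewMap_apply, PiLp.inner_apply, Fin.sum_univ_three]
  ring

/-- The vertices `±e₁, ±e₂, ±e₃` of the regular octahedron, with antipodal pairs adjacent in the
enumeration. -/
noncomputable def octahedronVertex : Fin 6 → EuclideanSpace ℝ (Fin 3) :=
  ![!₂[1, 0, 0], !₂[-1, 0, 0], !₂[0, 1, 0], !₂[0, -1, 0], !₂[0, 0, 1], !₂[0, 0, -1]]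

/-- The octahedron graph (`K₆` minus a perfect matching) is 3-rigid. -/
theorem octahedron_threeRigid :
    ((⊤ : SimpleGraph (Fin 6)).deleteEdges {s(0, 1), s(2, 3), s(4, 5)}).ThreeRigid := by
  refine ⟨octahedronVertex, fun q hq => ?_⟩
  have h02 := @hq 0 2 (by simp)
  have h03 := @hq 0 3 (by simp)
  have h04 := @hq 0 4 (by simp)
  have h05 := @hq 0 5 (by simp)
  have h12 := @hq 1 2 (by simp)
  have h13 := @hq 1 3 (by simp)
  have h14 := @hq 1 4 (by simp)
  have h15 := @hq 1 5 (by simp)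
  have h24 := @hq 2 4 (by simp)
  have h25 := @hq 2 5 (by simp)
  have h34 := @hq 3 4 (by simp)
  have h35 := @hq 3 5 (by simp)
  simp [octahedronVertex, PiLp.inner_apply, Fin.sum_univ_three]
    at h02 h03 h04 h05 h12 h13 h14 h15 h24 h25 h34 h35
  refine ⟨skewMap ((q 0 1 - q 1 1) / 2) ((q 0 2 - q 1 2) / 2) ((q 2 2 - q 3 2) / 2),
    (2⁻¹ : ℝ) • (q 0 + q 1), inner_skewMap_left _ _ _, fun v => ?_⟩
  ext i
  fin_cases v <;> fin_cases i <;> simp [skewMap_apply, octahedronVertex] <;> linarith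
end

section
/- The graph obtained from the complete graph K₆ by deleting the three edges of a triangle is 3-rigid; that is, it admits an infinitesimally rigid framework in ℝ³. -/
open scoped RealInnerProductSpace

/-- `K₆` minus the three edges of a triangle is 3-rigid. -/
theorem K6_minus_triangle_threeRigid :
    ((⊤ : SimpleGraph (Fin 6)).deleteEdges {s(0, 1), s(1, 2), s(0, 2)}).ThreeRigid := by
  refine ⟨![!₂[0, 0, 1], !₂[0, 0, 2], !₂[0, 0, 3], !₂[0, 0, 0], !₂[1, 0, 0], !₂[0, 1, 0]], ?_⟩
  intro q hq
  have h34 := hq (show SimpleGraph.Adj _ 3 4 by simp)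
  have h35 := hq (show SimpleGraph.Adj _ 3 5 by simp)
  have h45 := hq (show SimpleGraph.Adj _ 4 5 by simp)
  have h03 := hq (show SimpleGraph.Adj _ 0 3 by simp)
  have h04 := hq (show SimpleGraph.Adj _ 0 4 by simp)
  have h05 := hq (show SimpleGraph.Adj _ 0 5 by simp)
  have h13 := hq (show SimpleGraph.Adj _ 1 3 by simp)
  have h14 := hq (show SimpleGraph.Adj _ 1 4 by simp)
  have h15 := hq (show SimpleGraph.Adj _ 1 5 by simp)
  have h23 := hq (show SimpleGraph.Adj _ 2 3 by simp)
  have h24 := hq (show SimpleGraph.Adj _ 2 4 by simp)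
  have h25 := hq (show SimpleGraph.Adj _ 2 5 by simp)
  simp [PiLp.inner_apply, Fin.sum_univ_three] at h34 h35 h45 h03 h04 h05 h13 h14 h15 h23 h24 h25
  refine ⟨Matrix.toEuclideanLin
    !![0, -(q 4 1 - q 3 1), -(q 4 2 - q 3 2);
      q 4 1 - q 3 1, 0, -(q 5 2 - q 3 2);
      q 4 2 - q 3 2, q 5 2 - q 3 2, 0], q 3, ?_, ?_⟩
  · intro x y
    simp [PiLp.inner_apply, Fin.sum_univ_three, Matrix.toLpLin_apply, dotProduct]
    ring
  · intro v
    ext i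
    fin_cases v <;> fin_cases i <;>
      simp [Matrix.toLpLin_apply] <;> linarith
end

section
/- The graph obtained from the complete graph K₆ by deleting the three edges of a path with three edges is 3-rigid; that is, it admits an infinitesimally rigid framework in ℝ³. -/
open scoped RealInnerProductSpace

/-- `K₆` minus the three edges of a path with three edges is 3-rigid. -/
theorem K6_minus_path3_threeRigid :
    ((⊤ : SimpleGraph (Fin 6)).deleteEdges {s(0, 1), s(1, 2), s(2, 3)}).ThreeRigid := by
  refine ⟨![!₂[0, 1, 0], !₂[0, -1, 0], !₂[0, 0, -1], !₂[0, 0, 1], !₂[0, 0, 0], !₂[1, 0, 0]],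
    fun q hq => ?_⟩
  have h02 := @hq 0 2 (by simp)
  have h03 := @hq 0 3 (by simp)
  have h04 := @hq 0 4 (by simp)
  have h05 := @hq 0 5 (by simp)
  have h13 := @hq 1 3 (by simp)
  have h14 := @hq 1 4 (by simp)
  have h15 := @hq 1 5 (by simp)
  have h24 := @hq 2 4 (by simp)
  have h25 := @hq 2 5 (by simp)
  have h34 := @hq 3 4 (by simp)
  have h35 := @hq 3 5 (by simp)
  have h45 := @hq 4 5 (by simp)
  simp [PiLp.inner_apply, Fin.sum_univ_three] at h02 h03 h04 h05 h13 h14 h15 h24 h25 h34 h35 h45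
  let a := q 0 0 - q 4 0
  let b := q 3 0 - q 4 0
  let c := q 3 1 - q 4 1
  refine ⟨Matrix.toEuclideanLin !![0, a, b; -a, 0, c; -b, -c, 0], q 4, fun x y => ?_, fun v => ?_⟩
  · simp [PiLp.inner_apply, Fin.sum_univ_three, Matrix.toLpLin_apply, dotProduct]
    ring
  · ext i
    fin_cases v <;> fin_cases i <;>
      simp [Matrix.toLpLin_apply] <;>
      linarith
end

section
/- The graph obtained from the complete graph K₆ by deleting three edges forming a two-edge path together with a disjoint edge is 3-rigid; that is, it admits an infinitesimally rigid framework in ℝ³. -/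
open scoped RealInnerProductSpace

/-- `K₆` minus three edges forming a two-edge path together with a disjoint
edge is 3-rigid. -/
theorem K6_minus_path2_plus_edge_threeRigid :
    ((⊤ : SimpleGraph (Fin 6)).deleteEdges {s(0, 1), s(1, 2), s(3, 4)}).ThreeRigid := by
  refine ⟨![!₂[1, 0, 0], !₂[1, -1, 0], !₂[0, 1, 0], !₂[1, 1, 1], !₂[0, 0, 1], !₂[0, 0, 0]],
    fun q hq => ?_⟩
  have h02 := @hq 0 2 (by simp)
  have h03 := @hq 0 3 (by simp)
  have h04 := @hq 0 4 (by simp)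
  have h05 := @hq 0 5 (by simp)
  have h13 := @hq 1 3 (by simp)
  have h14 := @hq 1 4 (by simp)
  have h15 := @hq 1 5 (by simp)
  have h23 := @hq 2 3 (by simp)
  have h24 := @hq 2 4 (by simp)
  have h25 := @hq 2 5 (by simp)
  have h35 := @hq 3 5 (by simp)
  have h45 := @hq 4 5 (by simp)
  simp [PiLp.inner_apply, Fin.sum_univ_three] at h02 h03 h04 h05 h13 h14 h15 h23 h24 h25 h35 h45
  refine ⟨Matrix.toEuclideanLin
    !![0, q 2 0 - q 5 0, q 4 0 - q 5 0;
      -(q 2 0 - q 5 0), 0, q 4 1 - q 5 1;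
      -(q 4 0 - q 5 0), -(q 4 1 - q 5 1), 0], q 5, fun x y => ?_, fun v => ?_⟩
  · simp [PiLp.inner_apply, Fin.sum_univ_three, Matrix.toLpLin_apply,
      dotProduct]
    ring
  · ext i
    fin_cases v <;> fin_cases i <;>
      simp [Matrix.toLpLin_apply] <;>
      linarith
end
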